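/- arXiv:2410.22190 — 2 statements merged into one kernel-verified Lean document; each statement's English description precedes it below -/
import Mathlib

section
/- (Second derivative of pressure as a variance.) Let f : Ω → ℝ be Lipschitz and normalized (L_f(1) ≡ 1), let μ_f be a T-invariant Borel probability on Ω with ∫ L_f(w) dμ_f = ∫ w dμ_f for every bounded continuous w, and let g : Ω → ℝ be Lipschitz. Suppose p : ℝ → ℝ is twice continuously differentiable near 0 with p(0) = 0 and p′(0) = ∫_Ω g dμ_f, and φ : ℝ → C(Ω, ℝ), t ↦ φ_t, is twice continuously differentiable near 0 in the supremum norm, such that for all t near 0 and all x ∈ Ω, ∫_M e^{f(ax) + t g(ax) + φ_t(ax) − φ_t(x) − p(t)} dν(a) = 1. Then, writing ψ := (d/dt)φ_t |_{t=0} ∈ C(Ω, ℝ), p″(0) = ∫_Ω ( g − ∫_Ω g dμ_f + ψ − ψ∘T )² dμ_f. -/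
open MeasureTheory Filter Topology

noncomputable section

/-- The left shift on the sequence space `ℕ → M`. -/
def shift {M : Type*} (x : ℕ → M) : ℕ → M := fun n => x (n + 1)

/-- Prepending a symbol `a` to a sequence `x`, so that `shift (cons' a x) = x`. -/
def cons' {M : Type*} (a : M) (x : ℕ → M) : ℕ → M
  | 0 => a
  | n + 1 => x n

/-- The metric `d(x,y) = Σ_n 2⁻ⁿ d_M(x_n, y_n)` on the sequence space `Ω = M^ℕ`. -/
def seqDist {M : Type*} [MetricSpace M] (x y : ℕ → M) : ℝ :=
  ∑' n : ℕ, (1 / 2 : ℝ) ^ n * dist (x n) (y n)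

/-- A function `Ω → ℝ` is Lipschitz for the metric `seqDist`. -/
def LipschitzSeq {M : Type*} [MetricSpace M] (f : (ℕ → M) → ℝ) : Prop :=
  ∃ K : ℝ, 0 ≤ K ∧ ∀ x y, |f x - f y| ≤ K * seqDist x y

/-- The Ruelle operator with a priori measure `ν` and potential `f`. -/
def ruelle {M : Type*} [MeasurableSpace M] (ν : Measure M)
    (f w : (ℕ → M) → ℝ) : (ℕ → M) → ℝ :=
  fun x => ∫ a, Real.exp (f (cons' a x)) * w (cons' a x) ∂ν

theorem aux_cont {M : Type*} [MetricSpace M] [CompactSpace M] (g : (ℕ → M) → ℝ)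
    (hg : LipschitzSeq g) : Continuous g := by
  obtain ⟨K, hK, h⟩ := hg
  have hd : ∀ y : ℕ → M, Continuous (fun x => seqDist x y) := by
    intro y
    unfold seqDist
    have hs : Summable (fun n : ℕ => (1 / 2 : ℝ) ^ n * Metric.diam (Set.univ : Set M)) :=
      (summable_geometric_two).mul_right _
    refine continuous_tsum (fun n => by fun_prop) hs ?_
    intro n x
    rw [Real.norm_of_nonneg (by positivity)]
    gcongr
    exact Metric.dist_le_diam_of_mem isCompact_univ.isBounded (Set.mem_univ _) (Set.mem_univ _)
  rw [continuous_iff_continuousAt]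
  intro y
  rw [ContinuousAt, tendsto_iff_dist_tendsto_zero]
  have h0 : Tendsto (fun x => K * seqDist x y) (𝓝 y) (𝓝 0) := by
    have := ((hd y).const_mul K).tendsto y
    simpa [seqDist] using this
  exact squeeze_zero (fun _ => dist_nonneg) (fun x => by rw [Real.dist_eq]; exact h x y) h0

theorem aux_shift {M : Type*} [TopologicalSpace M] :
    Continuous (shift : (ℕ → M) → (ℕ → M)) := by
  unfold shift; fun_prop

theorem aux_exp {X : Type*} [TopologicalSpace X] [CompactSpace X] (u : C(X, ℝ)) (x : X) :
    (NormedSpace.exp u) x = Real.exp (u x) := by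
  have := NormedSpace.map_exp (ContinuousMap.evalAlgHom ℝ ℝ x)
    (ContinuousEvalConst.continuous_eval_const x) u
  rw [Real.exp_eq_exp_ℝ]
  exact this

theorem aux_int {X : Type*} [TopologicalSpace X] [CompactSpace X] [MeasurableSpace X]
    [OpensMeasurableSpace X] (μ : Measure X) [IsProbabilityMeasure μ] (u : C(X, ℝ)) :
    Integrable (fun x => u x) μ := by
  refine Integrable.of_bound u.continuous.measurable.aestronglyMeasurable ‖u‖ ?_
  exact Eventually.of_forall fun x => u.norm_coe_le_norm x

/-- Integration as a continuous linear functional. -/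
def auxI {X : Type*} [TopologicalSpace X] [CompactSpace X] [MeasurableSpace X]
    [OpensMeasurableSpace X] (μ : Measure X) [IsProbabilityMeasure μ] : C(X, ℝ) →L[ℝ] ℝ :=
  LinearMap.mkContinuous
    { toFun := fun u => ∫ x, u x ∂μ
      map_add' := fun u v => integral_add (aux_int μ u) (aux_int μ v)
      map_smul' := fun c u => integral_const_mul c _ } 1 (fun u => by
        have := norm_integral_le_of_norm_le_const (μ := μ) (f := fun x => u x)
          (Eventually.of_forall fun x => u.norm_coe_le_norm x)
        simpa using this)

theorem auxI_apply {X : Type*} [TopologicalSpace X] [CompactSpace X] [MeasurableSpace X]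
    [OpensMeasurableSpace X] (μ : Measure X) [IsProbabilityMeasure μ] (u : C(X, ℝ)) :
    auxI μ u = ∫ x, u x ∂μ := rfl

/-- Composition as a continuous linear map. -/
def auxC {X : Type*} [TopologicalSpace X] [CompactSpace X] (T : C(X, X)) :
    C(X, ℝ) →L[ℝ] C(X, ℝ) :=
  ⟨{ toFun := fun u => u.comp T
     map_add' := fun _ _ => rfl
     map_smul' := fun _ _ => rfl }, ContinuousMap.continuous_precomp T⟩

theorem auxC_apply {X : Type*} [TopologicalSpace X] [CompactSpace X] (T : C(X, X))
    (u : C(X, ℝ)) (x : X) : auxC T u x = u (T x) := rfl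

/-- first and second derivative data from `ContDiffAt 2`. -/
theorem aux_deriv {E : Type*} [NormedAddCommGroup E] [NormedSpace ℝ E] (φ : ℝ → E)
    (h : ContDiffAt ℝ 2 φ 0) : (∀ᶠ t in 𝓝 (0 : ℝ), HasDerivAt φ (deriv φ t) t) ∧
      HasDerivAt (deriv φ) (deriv (deriv φ) 0) 0 := by
  constructor
  · filter_upwards [h.eventually (by simp)] with t ht
    exact (ht.differentiableAt (by simp)).hasDerivAt
  · obtain ⟨u, hu, hc⟩ := h.contDiffOn (m := 2) le_rfl (by simp)
    have : ContDiffAt ℝ 1 (deriv φ) 0 := by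
      have h1 : ContDiffAt ℝ 1 (fderiv ℝ φ) 0 := h.fderiv_right (by norm_num)
      have h2 := h1.clm_apply (contDiffAt_const (c := (1 : ℝ)))
      exact h2
    exact (this.differentiableAt (by simp)).hasDerivAt

/-- the second derivative of the pressure is the variance of
`g − ∫ g dμ_f + ψ − ψ∘T`, where `ψ` is the derivative at `0` of the family
`φ_t = log w_{f+tg}` of logarithms of eigenfunctions. -/
theorem stmt_14 {M : Type*} [MetricSpace M] [CompactSpace M]
    [MeasurableSpace M] [BorelSpace M]
    (ν : Measure M) [IsProbabilityMeasure ν] [ν.IsOpenPosMeasure]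
    (f : (ℕ → M) → ℝ) (hf : LipschitzSeq f)
    (hnorm : ∀ x, ruelle ν f (fun _ => (1 : ℝ)) x = 1)
    (μ : Measure (ℕ → M)) [IsProbabilityMeasure μ]
    (hinv : Measure.map shift μ = μ)
    (hfix : ∀ w : (ℕ → M) → ℝ, Continuous w →
      ∫ x, ruelle ν f w x ∂μ = ∫ x, w x ∂μ)
    (g : (ℕ → M) → ℝ) (hg : LipschitzSeq g)
    (p : ℝ → ℝ) (hp : ContDiffAt ℝ 2 p 0)
    (hp0 : p 0 = 0) (hp1 : deriv p 0 = ∫ x, g x ∂μ)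
    (φ : ℝ → C(ℕ → M, ℝ)) (hφ : ContDiffAt ℝ 2 φ 0)
    (hJac : ∀ᶠ t in 𝓝 (0 : ℝ), ∀ x : ℕ → M,
      ∫ a, Real.exp (f (cons' a x) + t * g (cons' a x)
        + φ t (cons' a x) - φ t x - p t) ∂ν = 1) :
    deriv (deriv p) 0
      = ∫ x, (g x - (∫ y, g y ∂μ) + (deriv φ 0) x - (deriv φ 0) (shift x)) ^ 2 ∂μ := by
  have hgc := aux_cont g hg
  have hcs : ∀ (a : M) (x : ℕ → M), shift (cons' a x) = x := fun a x => rfl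
  let T : C(ℕ → M, ℕ → M) := ⟨shift, aux_shift⟩
  let G : C(ℕ → M, ℝ) := ⟨g, hgc⟩
  have hmp : MeasurePreserving shift μ μ := ⟨aux_shift.measurable, hinv⟩
  have hTinv : ∀ u : C(ℕ → M, ℝ), ∫ x, u (shift x) ∂μ = ∫ x, u x ∂μ := by
    intro u
    conv_rhs => rw [← hinv]
    exact (integral_map aux_shift.measurable.aemeasurable
      u.continuous.measurable.aestronglyMeasurable).symm
  -- `φ 0` is shift-invariant almost everywhere
  have hinv0 : ∀ᵐ x ∂μ, φ 0 x = φ 0 (shift x) := by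
    let h : C(ℕ → M, ℝ) := ⟨fun x => Real.exp (φ 0 x), by fun_prop⟩
    have hJ0 := hJac.self_of_nhds
    have h1 : ∫ x, h x * h (shift x) ∂μ = ∫ x, (h x) ^ 2 ∂μ := by
      rw [← hfix (fun x => h x * h (shift x))
        (h.continuous.mul (h.continuous.comp aux_shift))]
      congr 1
      ext x
      have h2 := hJ0 x
      simp only [ruelle, hcs]
      calc _ = ∫ a, (h x) ^ 2 * Real.exp (f (cons' a x) + 0 * g (cons' a x)
                + φ 0 (cons' a x) - φ 0 x - p 0) ∂ν := by
              congr 1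
              ext a
              simp only [h, ContinuousMap.coe_mk, hp0]
              rw [← Real.exp_add, ← Real.exp_add, ← Real.exp_nat_mul, ← Real.exp_add]
              congr 1
              push_cast
              ring
        _ = _ := by rw [integral_const_mul, h2, mul_one]
    have h3 : ∫ x, (h x - h (shift x)) ^ 2 ∂μ = 0 := by
      have e1 := aux_int μ (h ^ 2)
      have e2 := aux_int μ (h * h.comp T)
      have e3 := aux_int μ ((h ^ 2).comp T)
      have e4 := hTinv (h ^ 2)
      calc _ = ∫ x, ((h ^ 2) x - 2 * (h * h.comp T) x + ((h ^ 2).comp T) x) ∂μ := by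
              congr 1
              ext x
              simp [T]
              ring
        _ = ∫ x, (h ^ 2) x ∂μ - 2 * ∫ x, (h * h.comp T) x ∂μ
              + ∫ x, ((h ^ 2).comp T) x ∂μ := by
              have e5 : Integrable (fun x => (h ^ 2) x - 2 * (h * h.comp T) x) μ := e1.sub (e2.const_mul 2)
              rw [integral_add e5 e3, integral_sub e1 (e2.const_mul 2),
                integral_const_mul]
        _ = 0 := by
              have a1 : ∫ x, (h * h.comp T) x ∂μ = ∫ x, (h ^ 2) x ∂μ := h1
              have a2 : ∫ x, ((h ^ 2).comp T) x ∂μ = ∫ x, (h ^ 2) x ∂μ := e4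
              rw [a1, a2]; ring
    have h4 := (integral_eq_zero_iff_of_nonneg (fun x => sq_nonneg _)
      (aux_int μ ((h - h.comp T) ^ 2))).1 h3
    filter_upwards [h4] with x hx
    have hx' : (h x - h (shift x)) ^ 2 = 0 := hx
    have : h x = h (shift x) := by
      have := pow_eq_zero_iff (two_ne_zero) |>.1 hx'
      linarith
    exact Real.exp_injective this
  obtain ⟨hφ1, hφ2⟩ := aux_deriv φ hφ
  obtain ⟨hq1, hq2⟩ := aux_deriv p hp
  let F : ℝ → C(ℕ → M, ℝ) := fun t => t • G + φ t - auxC T (φ t) - p t • 1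
  let F' : ℝ → C(ℕ → M, ℝ) :=
    fun t => (1 : ℝ) • G + deriv φ t - auxC T (deriv φ t) - deriv p t • 1
  let F'' : C(ℕ → M, ℝ) :=
    deriv (deriv φ) 0 - auxC T (deriv (deriv φ) 0) - deriv (deriv p) 0 • 1
  have hF : ∀ᶠ t in 𝓝 (0 : ℝ), HasDerivAt F (F' t) t := by
    filter_upwards [hφ1, hq1] with t h1 h2
    exact ((((hasDerivAt_id t).smul_const G).add h1).sub
      ((auxC T).hasFDerivAt.comp_hasDerivAt t h1)).sub (h2.smul_const (1 : C(ℕ → M, ℝ)))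
  have hF' : HasDerivAt F' F'' 0 := by
    have := (((hφ2.const_add ((1 : ℝ) • G))).sub
      ((auxC T).hasFDerivAt.comp_hasDerivAt 0 hφ2)).sub (hq2.smul_const (1 : C(ℕ → M, ℝ)))
    exact this
  have hE : ∀ᶠ t in 𝓝 (0 : ℝ),
      HasDerivAt (fun t => NormedSpace.exp (F t)) (NormedSpace.exp (F t) * F' t) t := by
    filter_upwards [hF] with t ht
    have := (hasFDerivAt_exp (𝕂 := ℝ) (x := F t)).comp_hasDerivAt t ht
    have h2 : (NormedSpace.exp (F t) • (1 : C(ℕ → M, ℝ) →L[ℝ] C(ℕ → M, ℝ))) (F' t)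
        = NormedSpace.exp (F t) * F' t := rfl
    rw [← h2]
    exact this
  have hH : ∀ᶠ t in 𝓝 (0 : ℝ), auxI μ (NormedSpace.exp (F t)) = 1 := by
    filter_upwards [hJac] with t ht
    rw [auxI_apply, ← hfix _ (NormedSpace.exp (F t) : C(ℕ → M, ℝ)).continuous]
    have : ∀ x, ruelle ν f (fun y => (NormedSpace.exp (F t) : C(ℕ → M, ℝ)) y) x = 1 := by
      intro x
      rw [← ht x, ruelle]
      congr 1
      ext a
      rw [aux_exp, ← Real.exp_add]
      congr 1
      simp [F, G, T, auxC_apply, hcs]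
      ring
    rw [integral_congr_ae (Eventually.of_forall this)]
    simp
  have hH1 : ∀ᶠ t in 𝓝 (0 : ℝ), auxI μ (NormedSpace.exp (F t) * F' t) = 0 := by
    filter_upwards [hE, hH.eventually_nhds] with t h1 h2
    have h3 := (auxI μ).hasFDerivAt.comp_hasDerivAt t h1
    have h4 : HasDerivAt (fun t => auxI μ (NormedSpace.exp (F t))) 0 t :=
      (hasDerivAt_const t (1 : ℝ)).congr_of_eventuallyEq h2
    exact h3.unique h4
  have hH2 : auxI μ (NormedSpace.exp (F 0) * F' 0 * F' 0 + NormedSpace.exp (F 0) * F'') = 0 := by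
    have h3 := (auxI μ).hasFDerivAt.comp_hasDerivAt 0 (hE.self_of_nhds.mul hF')
    have h4 : HasDerivAt (fun t => auxI μ (NormedSpace.exp (F t) * F' t)) 0 0 :=
      (hasDerivAt_const (0 : ℝ) (0 : ℝ)).congr_of_eventuallyEq hH1
    exact h3.unique h4
  rw [auxI_apply] at hH2
  have hfin : ∫ x, ((F' 0 ^ 2) x + F'' x) ∂μ = 0 := by
    refine Eq.trans ?_ hH2
    apply integral_congr_ae
    filter_upwards [hinv0] with x hx
    have h0 : F 0 x = 0 := by
      simp [F, T, auxC_apply, hp0, hx]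
    simp only [ContinuousMap.add_apply, ContinuousMap.mul_apply, aux_exp, h0, Real.exp_zero,
      ContinuousMap.pow_apply]
    ring
  rw [integral_add (aux_int μ _) (aux_int μ _)] at hfin
  have hF2 : ∫ x, F'' x ∂μ = - deriv (deriv p) 0 := by
    rw [← auxI_apply]
    simp only [F'', map_sub, map_smul, auxI_apply]
    have : ∫ x, auxC T (deriv (deriv φ) 0) x ∂μ = ∫ x, (deriv (deriv φ) 0) x ∂μ := hTinv _
    rw [this]
    simp
  have hF1 : ∫ x, (F' 0 ^ 2) x ∂μ
      = ∫ x, (g x - (∫ y, g y ∂μ) + (deriv φ 0) x - (deriv φ 0) (shift x)) ^ 2 ∂μ := by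
    congr 1
    ext x
    simp [F', G, T, auxC_apply, hp1]
    ring
  rw [hF2, hF1] at hfin
  linarith
end
end

section
/- (Constancy of the eigenfunction derivative in a kernel direction.) Let f : Ω → ℝ be Lipschitz and normalized (L_f(1) ≡ 1), let μ_f be a Borel probability on Ω with ∫ L_f(w) dμ_f = ∫ w dμ_f for every bounded continuous w, and let η : Ω → ℝ be Lipschitz with L_f(η) ≡ 0. Suppose λ : ℝ → ℝ is differentiable at 0 with λ(0) = 1, and W : ℝ → C(Ω, ℝ) is differentiable at 0 in the supremum norm with W(0) ≡ 1, and that L_{f+tη}(W(t)) = λ(t)·W(t) for all t ∈ ℝ. Assume moreover that every w ∈ C(Ω, ℝ) with L_f(w) = w is a constant function. Then the derivative v := W′(0) ∈ C(Ω, ℝ) is a constant function on Ω. -/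
open MeasureTheory Filter Topology

noncomputable section

theorem lipSeq_continuous {M : Type*} [MetricSpace M] [CompactSpace M]
    {f : (ℕ → M) → ℝ} (hf : LipschitzSeq f) : Continuous f := by
  obtain ⟨K, hK, h⟩ := hf
  rw [continuous_iff_continuousAt]
  intro x
  have hc : Continuous (fun y : ℕ → M => K * seqDist y x) := by
    refine continuous_const.mul ?_
    unfold seqDist
    refine continuous_tsum (u := fun n => (1 / 2 : ℝ) ^ n * Metric.diam (Set.univ : Set M))
      (fun n => by fun_prop) ?_ ?_
    · exact summable_geometric_two.mul_right _
    · intro n y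
      rw [Real.norm_of_nonneg (by positivity)]
      gcongr
      exact Metric.dist_le_diam_of_mem isCompact_univ.isBounded (Set.mem_univ _) (Set.mem_univ _)
  have h0 : K * seqDist x x = 0 := by simp [seqDist]
  have ht := hc.tendsto x
  simp only [h0] at ht
  unfold ContinuousAt
  rw [tendsto_iff_dist_tendsto_zero]
  exact squeeze_zero (fun _ => dist_nonneg) (fun y => by rw [Real.dist_eq]; exact h y x) ht

theorem cons_continuous {M : Type*} [TopologicalSpace M] (x : ℕ → M) :
    Continuous (fun a : M => cons' a x) := by
  refine continuous_pi fun n => ?_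
  cases n with
  | zero => exact continuous_id
  | succ n => exact continuous_const

theorem exists_functional {M : Type*} [MetricSpace M] [CompactSpace M]
    [MeasurableSpace M] [BorelSpace M]
    (ν : Measure M) [IsProbabilityMeasure ν] (F : C(ℕ → M, ℝ)) (x : ℕ → M) :
    ∃ Φ : C(ℕ → M, ℝ) →L[ℝ] ℝ, ∀ w, Φ w = ∫ a, Real.exp (F (cons' a x)) * w (cons' a x) ∂ν := by
  have hcons := cons_continuous x
  have hint : ∀ g : M → ℝ, Continuous g → Integrable g ν := fun g hg =>
    hg.integrable_of_hasCompactSupport (HasCompactSupport.of_compactSpace g)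
  refine ⟨LinearMap.mkContinuous
    { toFun := fun w => ∫ a, Real.exp (F (cons' a x)) * w (cons' a x) ∂ν
      map_add' := ?_
      map_smul' := ?_ } (∫ a, Real.exp (F (cons' a x)) ∂ν) ?_, fun w => rfl⟩
  · intro u v
    rw [← integral_add (hint _ (by fun_prop)) (hint _ (by fun_prop))]
    simp [mul_add]
  · intro c u
    simp only [RingHom.id_apply, smul_eq_mul]
    rw [← integral_const_mul]
    congr 1
    ext a
    simp
    ring
  · intro w
    simp only [LinearMap.coe_mk, AddHom.coe_mk]
    rw [← integral_mul_const]
    refine norm_integral_le_of_norm_le (hint _ (by fun_prop)) (Eventually.of_forall fun a => ?_)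
    rw [norm_mul, Real.norm_of_nonneg (Real.exp_pos _).le]
    gcongr
    exact w.norm_coe_le_norm _

theorem exp_apply' {X : Type*} [TopologicalSpace X] [CompactSpace X] (g : C(X, ℝ)) (x : X) :
    (NormedSpace.exp g) x = Real.exp (g x) := by
  have := NormedSpace.map_exp (ContinuousMap.evalAlgHom ℝ ℝ x) (ContinuousEvalConst.continuous_eval_const x) g
  rw [Real.exp_eq_exp_ℝ]
  exact this

/-- if the direction `η` lies in the kernel of `L_f` and the fixed
functions of `L_f` are the constants, then the derivative `v = W′(0)` of the
eigenfunction family is a constant function. -/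
theorem stmt_16 {M : Type*} [MetricSpace M] [CompactSpace M]
    [MeasurableSpace M] [BorelSpace M]
    (ν : Measure M) [IsProbabilityMeasure ν] [ν.IsOpenPosMeasure]
    (f : (ℕ → M) → ℝ) (hf : LipschitzSeq f)
    (hnorm : ∀ x, ruelle ν f (fun _ => (1 : ℝ)) x = 1)
    (μ : Measure (ℕ → M)) [IsProbabilityMeasure μ]
    (hfix : ∀ w : (ℕ → M) → ℝ, Continuous w →
      ∫ x, ruelle ν f w x ∂μ = ∫ x, w x ∂μ)
    (η : (ℕ → M) → ℝ) (hη : LipschitzSeq η)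
    (hker : ∀ x, ruelle ν f η x = 0)
    (lam : ℝ → ℝ) (hlam0 : lam 0 = 1) (hlamd : DifferentiableAt ℝ lam 0)
    (W : ℝ → C(ℕ → M, ℝ)) (V : C(ℕ → M, ℝ))
    (hW : HasDerivAt W V 0) (hW0 : W 0 = 1)
    (heig : ∀ (t : ℝ) (x : ℕ → M),
      ruelle ν (fun y => f y + t * η y) (fun y => W t y) x = lam t * W t x)
    (huniq : ∀ w : C(ℕ → M, ℝ),
      (∀ x, ruelle ν f (fun y => w y) x = w x) → ∃ b : ℝ, ∀ x, w x = b) :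
    ∃ b : ℝ, ∀ x, V x = b := by
  have hfc := lipSeq_continuous hf
  have hηc := lipSeq_continuous hη
  let F : C(ℕ → M, ℝ) := ⟨f, hfc⟩
  let E : C(ℕ → M, ℝ) := ⟨η, hηc⟩
  obtain ⟨c, hc⟩ : ∃ c, HasDerivAt lam c 0 := ⟨_, hlamd.hasDerivAt⟩
  have hexp : HasDerivAt (fun t : ℝ => NormedSpace.exp (t • E)) E 0 := by
    have := hasDerivAt_exp_smul_const (𝕂 := ℝ) E (0 : ℝ)
    simpa using this
  have hG : HasDerivAt (fun t : ℝ => NormedSpace.exp (t • E) * W t) (E + V) 0 := by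
    have := hexp.fun_mul hW
    simpa [hW0] using this
  have key : ∀ x, ruelle ν f (fun y => V y) x = V x + c := by
    intro x
    obtain ⟨Φ, hΦ⟩ := exists_functional ν F x
    have h1 := Φ.hasFDerivAt.comp_hasDerivAt (0 : ℝ) hG
    have h2 : HasDerivAt (fun t => lam t * W t x) (c + V x) 0 := by
      have hWx : HasDerivAt (fun t => W t x) (V x) 0 :=
        (ContinuousMap.evalCLM ℝ x : C(ℕ → M, ℝ) →L[ℝ] ℝ).hasFDerivAt.comp_hasDerivAt (0 : ℝ) hW
      have := hc.fun_mul hWx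
      simpa [hW0, hlam0] using this
    have he : (fun t => lam t * W t x) = Φ ∘ (fun t : ℝ => NormedSpace.exp (t • E) * W t) := by
      funext t
      rw [← heig t x, Function.comp_apply, hΦ]
      unfold ruelle
      congr 1
      ext a
      rw [ContinuousMap.mul_apply, exp_apply', Real.exp_add, mul_assoc]
      rfl
    rw [he] at h2
    have h3 := h1.unique h2
    have hE : Φ E = 0 := by rw [hΦ]; exact hker x
    have hV : Φ V = ruelle ν f (fun y => V y) x := by rw [hΦ]; rfl
    rw [map_add, hE, hV] at h3
    linarith
  have hVi : Integrable (fun x => V x) μ :=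
    V.continuous.integrable_of_hasCompactSupport (HasCompactSupport.of_compactSpace _)
  have hc0 : c = 0 := by
    have h := hfix (fun y => V y) V.continuous
    simp only [key] at h
    rw [integral_add hVi (integrable_const c)] at h
    simpa using h
  exact huniq V (fun x => by rw [key x, hc0, add_zero])
end
end
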